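/- Let 2 ≤ m ≤ N, let f₀ ∈ MvPolynomial (Fin (m+1)) ℂ be a nonzero homogeneous polynomial of degree d ≥ 2, let f be its image in S := MvPolynomial (Fin (N+1)) ℂ under the variable inclusion Fin (m+1) ↪ Fin (N+1), and let I be the ideal of S generated by f together with the variables x_{m+1},…,x_N. Consider the ℂ-subspace W of S-linear maps φ : I → S ⧸ I that preserve the grading, i.e. such that for every natural number e, φ sends every homogeneous element of I of degree e into the image of the homogeneous submodule of degree e under the quotient map S → S ⧸ I. Then the ℂ-dimension of W equals Nat.choose (m+d) m − 1 + (N−m)·(m+1). (This is the computation of the tangent space Hom_S(I, S/I)₀ of the Hilbert scheme Hilb_{P_{d,m}(T)}(ℙ^N) at the degree d hypersurface of an m-plane defined by I.) -/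

import Mathlib

open MvPolynomial

lemma aux_div {σ : Type*} {f₀ p : MvPolynomial σ ℂ} {d e : ℕ} (h0 : f₀ ≠ 0)
    (hf : f₀.IsHomogeneous d) (hp : (f₀ * p).IsHomogeneous (d + e)) : p.IsHomogeneous e := by
  let _ := MvPolynomial.gradedAlgebra (σ := σ) (R := ℂ)
  have h1 := DirectSum.coe_decompose_mul_add_of_left_mem (homogeneousSubmodule σ ℂ)
    (i := d) (j := e) (a := f₀) (b := p) hf
  rw [DirectSum.decompose_of_mem_same (homogeneousSubmodule σ ℂ) hp] at h1
  have h2 := mul_left_cancel₀ h0 h1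
  rw [h2]
  exact (DirectSum.decompose (homogeneousSubmodule σ ℂ) p e).2

lemma aux_finrank (m e : ℕ) :
    Module.finrank ℂ (homogeneousSubmodule (Fin (m + 1)) ℂ e) = Nat.choose (m + e) m := by
  rw [homogeneousSubmodule_eq_finsupp_supported]
  have hb := Module.finrank_eq_nat_card_basis
    (basisRestrictSupport ℂ {d : Fin (m + 1) →₀ ℕ | d.degree = e})
  refine hb.trans ?_
  have : Nat.card {d : Fin (m + 1) →₀ ℕ | d.degree = e} = Nat.card (Sym (Fin (m + 1)) e) := by
    refine Nat.card_congr (Equiv.trans (Equiv.subtypeEquivRight ?_) (Sym.equivNatSum _ e).symm)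
    intro x
    rw [Set.mem_setOf_eq, Finsupp.degree_apply]
    rfl
  rw [this, Nat.card_eq_fintype_card, Sym.card_sym_eq_choose, Fintype.card_fin]
  rw [show m + 1 + e - 1 = m + e by omega, ← Nat.choose_symm_add]

lemma aux_fin (m e : ℕ) : Module.Finite ℂ (homogeneousSubmodule (Fin (m + 1)) ℂ e) :=
  Module.Finite.iff_fg.2 (homogeneousSubmodule_fg _ _ _)

section
variable {m N : ℕ} (hmN : m ≤ N)

/-- inclusion -/
noncomputable abbrev inc : MvPolynomial (Fin (m + 1)) ℂ →ₐ[ℂ] MvPolynomial (Fin (N + 1)) ℂ :=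
  rename (Fin.castLE (Nat.succ_le_succ hmN))

/-- projection -/
noncomputable def prj (m N : ℕ) :
    MvPolynomial (Fin (N + 1)) ℂ →ₐ[ℂ] MvPolynomial (Fin (m + 1)) ℂ :=
  aeval (fun i => if h : (i : ℕ) < m + 1 then X ⟨i, h⟩ else 0)

lemma prj_inc (a) : prj m N (inc hmN a) = a := by
  have : (prj m N).comp (inc hmN) = AlgHom.id ℂ _ := by
    ext i : 1
    have := i.2
    simp [prj]
    omega
  exact DFunLike.congr_fun this a

lemma prj_X {i : Fin (N + 1)} (h : m < (i : ℕ)) : prj m N (X i) = 0 := by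
  simp [prj, h]

lemma prj_hom {x : MvPolynomial (Fin (N + 1)) ℂ} {e : ℕ} (h : x.IsHomogeneous e) :
    (prj m N x).IsHomogeneous e := by
  have := h.aeval (n := 1) (fun i : Fin (N + 1) =>
    if h : (i : ℕ) < m + 1 then (X ⟨i, h⟩ : MvPolynomial (Fin (m + 1)) ℂ) else 0) (by
      intro i
      split_ifs
      · exact isHomogeneous_X _ _
      · exact isHomogeneous_zero _ _ _)
  rwa [one_mul] at this

lemma mk_inc_prj {I : Ideal (MvPolynomial (Fin (N + 1)) ℂ)}
    (hX : ∀ i : Fin (N + 1), m < (i : ℕ) → X i ∈ I) (x) :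
    Ideal.Quotient.mk I (inc hmN (prj m N x)) = Ideal.Quotient.mk I x := by
  have : ((Ideal.Quotient.mkₐ ℂ I).comp ((inc hmN).comp (prj m N))) = Ideal.Quotient.mkₐ ℂ I := by
    ext i : 1
    by_cases h : m < (i : ℕ)
    · simp only [AlgHom.comp_apply, prj_X h, map_zero]
      exact (Ideal.Quotient.eq_zero_iff_mem.2 (hX i h)).symm
    · have h' : (i : ℕ) < m + 1 := by omega
      simp only [AlgHom.comp_apply]
      congr 1
      simp only [prj, aeval_X, dif_pos h', rename_X]
      rfl
  exact DFunLike.congr_fun this x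

lemma pderiv_inc {j : Fin (N + 1)} (h : m < (j : ℕ)) (a) : pderiv j (inc hmN a) = 0 := by
  induction a using MvPolynomial.induction_on with
  | C a => simp
  | add p q hp hq => simp only [map_add, hp, hq, add_zero]
  | mul_X p i hp =>
    have : Fin.castLE (Nat.succ_le_succ hmN) i ≠ j := by
      intro hh
      have := congrArg Fin.val hh
      have h2 := i.2
      simp at this
      omega
    rw [map_mul, Derivation.leibniz, hp]
    simp [pderiv_X_of_ne this]

end

lemma ext_span {S M : Type*} [CommRing S] [AddCommGroup M] [Module S M] {I : Ideal S} {s : Set S}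
    (hI : I = Ideal.span s) (φ ψ : I →ₗ[S] M)
    (h : ∀ g (hg : g ∈ I), g ∈ s → φ ⟨g, hg⟩ = ψ ⟨g, hg⟩) : φ = ψ := by
  subst hI
  ext ⟨x, hx⟩
  refine Submodule.span_induction
    (p := fun x hx => φ ⟨x, hx⟩ = ψ ⟨x, hx⟩) ?_ ?_ ?_ ?_ hx
  · intro x hx
    exact h x _ hx
  · exact (φ.map_zero).trans (ψ.map_zero).symm
  · intro x y hx hy h1 h2
    have e1 := φ.map_add ⟨x, hx⟩ ⟨y, hy⟩
    have e2 := ψ.map_add ⟨x, hx⟩ ⟨y, hy⟩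
    rw [h1, h2] at e1
    exact e1.trans e2.symm
  · intro a x hx h1
    have e1 := φ.map_smul a ⟨x, hx⟩
    have e2 := ψ.map_smul a ⟨x, hx⟩
    rw [h1] at e1
    exact e1.trans e2.symm

section
variable {m N : ℕ} (hmN : m ≤ N) {f₀ : MvPolynomial (Fin (m + 1)) ℂ}
  {I : Ideal (MvPolynomial (Fin (N + 1)) ℂ)}

/-- quotient of the projection by `f₀` -/
noncomputable def quo (hdiv : ∀ x ∈ I, f₀ ∣ prj m N x) (x : I) : MvPolynomial (Fin (m + 1)) ℂ :=
  Classical.choose (hdiv x x.2)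

lemma quo_spec (hdiv : ∀ x ∈ I, f₀ ∣ prj m N x) (x : I) :
    prj m N x = f₀ * quo hdiv x := Classical.choose_spec (hdiv x x.2)

lemma quo_eq (h0 : f₀ ≠ 0) (hdiv : ∀ x ∈ I, f₀ ∣ prj m N x) (x : I) {p}
    (h : prj m N x = f₀ * p) : quo hdiv x = p :=
  mul_left_cancel₀ h0 ((quo_spec hdiv x).symm.trans h)

lemma quo_add (h0 : f₀ ≠ 0) (hdiv : ∀ x ∈ I, f₀ ∣ prj m N x) (x y : I) :
    quo hdiv (x + y) = quo hdiv x + quo hdiv y := by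
  apply quo_eq h0
  rw [mul_add, ← quo_spec, ← quo_spec]
  exact map_add _ _ _

lemma quo_smul (h0 : f₀ ≠ 0) (hdiv : ∀ x ∈ I, f₀ ∣ prj m N x) (s) (x : I) :
    quo hdiv (s • x) = prj m N s * quo hdiv x := by
  apply quo_eq h0
  rw [mul_left_comm, ← quo_spec]
  exact map_mul _ _ _

/-- the lift of the value of the constructed map -/
noncomputable def val (hdiv : ∀ x ∈ I, f₀ ∣ prj m N x) (a : MvPolynomial (Fin (m + 1)) ℂ)
    (b : {i : Fin (N + 1) // m < (i : ℕ)} → MvPolynomial (Fin (m + 1)) ℂ) (x : I) :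
    MvPolynomial (Fin (N + 1)) ℂ :=
  inc hmN (a * quo hdiv x) + ∑ j, inc hmN (b j) * pderiv j.1 x.1

/-- the constructed map -/
noncomputable def phi (h0 : f₀ ≠ 0) (hdiv : ∀ x ∈ I, f₀ ∣ prj m N x)
    (hX : ∀ i : Fin (N + 1), m < (i : ℕ) → X i ∈ I) (a : MvPolynomial (Fin (m + 1)) ℂ)
    (b : {i : Fin (N + 1) // m < (i : ℕ)} → MvPolynomial (Fin (m + 1)) ℂ) :
    I →ₗ[MvPolynomial (Fin (N + 1)) ℂ] (MvPolynomial (Fin (N + 1)) ℂ ⧸ I) where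
  toFun x := Ideal.Quotient.mk I (val hmN hdiv a b x)
  map_add' x y := by
    rw [← map_add]
    congr 1
    simp only [val, quo_add h0, Submodule.coe_add, map_add, mul_add, Finset.sum_add_distrib]
    ring
  map_smul' s x := by
    have hx : Ideal.Quotient.mk I x.1 = 0 := Ideal.Quotient.eq_zero_iff_mem.2 x.2
    change _ = Ideal.Quotient.mk I s * Ideal.Quotient.mk I _
    simp only [val, quo_smul h0, Submodule.coe_smul, smul_eq_mul, Derivation.leibniz]
    simp only [map_add, map_mul, map_sum, mk_inc_prj hmN hX, hx, mul_add, Finset.mul_sum,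
      zero_mul, mul_zero, add_zero]
    congr 1
    · ring
    · refine Finset.sum_congr rfl fun j _ => ?_
      ring

lemma val_hom {d : ℕ} (h0 : f₀ ≠ 0) (hf : f₀.IsHomogeneous d)
    (hdiv : ∀ x ∈ I, f₀ ∣ prj m N x) (a : MvPolynomial (Fin (m + 1)) ℂ)
    (b : {i : Fin (N + 1) // m < (i : ℕ)} → MvPolynomial (Fin (m + 1)) ℂ)
    (ha : a.IsHomogeneous d) (hb : ∀ j, (b j).IsHomogeneous 1) (x : I) {e : ℕ}
    (hx : x.1.IsHomogeneous e) : (val hmN hdiv a b x).IsHomogeneous e := by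
  refine IsHomogeneous.add ?_ (IsHomogeneous.sum _ _ _ fun j _ => ?_)
  · apply IsHomogeneous.rename_isHomogeneous
    apply aux_div h0 hf
    rw [mul_left_comm, ← quo_spec]
    exact ha.mul (prj_hom hx)
  · rcases Nat.eq_zero_or_pos e with rfl | he
    · have : pderiv j.1 x.1 = 0 := by
        rw [← totalDegree_zero_iff_isHomogeneous, totalDegree_eq_zero_iff_eq_C] at hx
        rw [hx, pderiv_C]
      rw [this, mul_zero]
      exact isHomogeneous_zero _ _ _
    · have := ((hb j).rename_isHomogeneous (f := Fin.castLE (Nat.succ_le_succ hmN))).mul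
        (hx.pderiv (i := j.1))
      rwa [show 1 + (e - 1) = e by omega] at this

lemma val_f (h0 : f₀ ≠ 0) (hdiv : ∀ x ∈ I, f₀ ∣ prj m N x) (a b) (hfI : inc hmN f₀ ∈ I) :
    val hmN hdiv a b ⟨inc hmN f₀, hfI⟩ = inc hmN a := by
  have : quo hdiv ⟨inc hmN f₀, hfI⟩ = 1 := quo_eq h0 _ _ (by rw [prj_inc, mul_one])
  rw [val, this, mul_one, Finset.sum_eq_zero, add_zero]
  intro j _
  rw [pderiv_inc hmN j.2, mul_zero]

lemma val_X (h0 : f₀ ≠ 0) (hdiv : ∀ x ∈ I, f₀ ∣ prj m N x) (a b)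
    (j : {i : Fin (N + 1) // m < (i : ℕ)}) (hj : X j.1 ∈ I) :
    val hmN hdiv a b ⟨X j.1, hj⟩ = inc hmN (b j) := by
  have : quo hdiv ⟨X j.1, hj⟩ = 0 := quo_eq h0 _ _ (by rw [prj_X j.2, mul_zero])
  rw [val, this, mul_zero, map_zero, zero_add, Finset.sum_eq_single j]
  · simp
  · intro k _ hk
    have : j.1 ≠ k.1 := fun h => hk (Subtype.ext h.symm)
    simp [pderiv_X_of_ne this]
  · simp

/-- the parametrization -/
noncomputable def Psi (d : ℕ) (h0 : f₀ ≠ 0) (hdiv : ∀ x ∈ I, f₀ ∣ prj m N x)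
    (hX : ∀ i : Fin (N + 1), m < (i : ℕ) → X i ∈ I) :
    (homogeneousSubmodule (Fin (m + 1)) ℂ d ×
      ({i : Fin (N + 1) // m < (i : ℕ)} → homogeneousSubmodule (Fin (m + 1)) ℂ 1)) →ₗ[ℂ]
    (I →ₗ[MvPolynomial (Fin (N + 1)) ℂ] (MvPolynomial (Fin (N + 1)) ℂ ⧸ I)) where
  toFun p := phi hmN h0 hdiv hX p.1 (fun j => p.2 j)
  map_add' p q := by
    ext x
    change Ideal.Quotient.mk I _ = Ideal.Quotient.mk I _ + Ideal.Quotient.mk I _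
    rw [← map_add]
    congr 1
    simp only [val, Prod.fst_add, Prod.snd_add, Pi.add_apply, Submodule.coe_add, map_add, add_mul,
      Finset.sum_add_distrib]
    ring
  map_smul' c p := by
    ext x
    change Ideal.Quotient.mkₐ ℂ I _ = c • Ideal.Quotient.mkₐ ℂ I _
    rw [← map_smul]
    congr 1
    simp only [val, Prod.smul_fst, Prod.smul_snd, Pi.smul_apply, Submodule.coe_smul, map_smul,
      smul_mul_assoc, smul_add, Finset.smul_sum, RingHom.id_apply]

lemma Psi_apply (d : ℕ) (h0 : f₀ ≠ 0) (hdiv : ∀ x ∈ I, f₀ ∣ prj m N x)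
    (hX : ∀ i : Fin (N + 1), m < (i : ℕ) → X i ∈ I) (p) (x : I) :
    Psi hmN d h0 hdiv hX p x = Ideal.Quotient.mk I (val hmN hdiv p.1 (fun j => p.2 j) x) := rfl

end


/-- Tangent space computation for the Hilbert scheme of degree-`d` hypersurfaces of `m`-planes
in `ℙ^N`: if `I = (f, x_{m+1}, …, x_N)` with `f` the image of a nonzero homogeneous
`f₀ ∈ ℂ[x₀,…,x_m]` of degree `d ≥ 2`, and `W` is the `ℂ`-subspace of grading-preserving
`S`-linear maps `φ : I → S ⧸ I`, then `dim_ℂ W = C(m+d, m) - 1 + (N-m)(m+1)`. -/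
theorem finrank_graded_hom_ideal_quotient
    {m N d : ℕ} (hm : 2 ≤ m) (hmN : m ≤ N) (hd : 2 ≤ d)
    (f₀ : MvPolynomial (Fin (m + 1)) ℂ) (hf0 : f₀ ≠ 0) (hf : f₀.IsHomogeneous d)
    (f : MvPolynomial (Fin (N + 1)) ℂ)
    (hf' : f = MvPolynomial.rename (Fin.castLE (Nat.succ_le_succ hmN)) f₀)
    (I : Ideal (MvPolynomial (Fin (N + 1)) ℂ))
    (hI : I = Ideal.span
      (insert f (MvPolynomial.X '' {i : Fin (N + 1) | m < (i : ℕ)})))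
    (W : Submodule ℂ
      (↥I →ₗ[MvPolynomial (Fin (N + 1)) ℂ] (MvPolynomial (Fin (N + 1)) ℂ ⧸ I)))
    (hW : ∀ φ, φ ∈ W ↔
      ∀ (e : ℕ) (x : MvPolynomial (Fin (N + 1)) ℂ) (hx : x ∈ I),
        x.IsHomogeneous e →
          φ ⟨x, hx⟩ ∈
            Submodule.map (Ideal.Quotient.mkₐ ℂ I).toLinearMap
              (MvPolynomial.homogeneousSubmodule (Fin (N + 1)) ℂ e)) :
    Module.finrank ℂ W = Nat.choose (m + d) m - 1 + (N - m) * (m + 1) := by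
  classical
  subst hf'
  have hX : ∀ i : Fin (N + 1), m < (i : ℕ) → X i ∈ I := fun i hi => by
    rw [hI]
    exact Ideal.subset_span (Or.inr ⟨i, hi, rfl⟩)
  have hfI : inc hmN f₀ ∈ I := by
    rw [hI]
    exact Ideal.subset_span (Or.inl rfl)
  have hdiv : ∀ x ∈ I, f₀ ∣ prj m N x := by
    have : I ≤ (Ideal.span {f₀}).comap (prj m N) := by
      rw [hI, Ideal.span_le]
      rintro x (rfl | ⟨i, hi, rfl⟩)
      · simp only [SetLike.mem_coe, Ideal.mem_comap]
        rw [prj_inc hmN]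
        exact Ideal.mem_span_singleton_self _
      · simp only [SetLike.mem_coe, Ideal.mem_comap]
        rw [prj_X hi]
        exact zero_mem _
    intro x hx
    exact Ideal.mem_span_singleton.1 (this hx)
  have hrange : LinearMap.range (Psi hmN d hf0 hdiv hX) = W := by
    ext φ
    rw [hW]
    constructor
    · rintro ⟨p, rfl⟩ e x hx hxe
      exact ⟨_, val_hom hmN hf0 hf hdiv p.1 (fun j => p.2 j) p.1.2 (fun j => (p.2 j).2)
        ⟨x, hx⟩ hxe, rfl⟩
    · intro h
      obtain ⟨s, hs, hs'⟩ := h d _ hfI hf.rename_isHomogeneous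
      have hb := fun j : {i : Fin (N + 1) // m < (i : ℕ)} =>
        h 1 _ (hX j.1 j.2) (isHomogeneous_X _ _)
      choose t ht ht' using hb
      refine ⟨(⟨prj m N s, prj_hom hs⟩, fun j => ⟨prj m N (t j), prj_hom (ht j)⟩), ?_⟩
      apply ext_span hI
      rintro x hx (rfl | ⟨i, hi, rfl⟩)
      · rw [Psi_apply, val_f hmN hf0, mk_inc_prj hmN hX]
        exact hs'
      · rw [Psi_apply, val_X hmN hf0 hdiv _ _ ⟨i, hi⟩, mk_inc_prj hmN hX]
        exact ht' ⟨i, hi⟩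
  have hzero : ∀ a, Ideal.Quotient.mk I (inc hmN a) = 0 → f₀ ∣ a := by
    intro a ha
    have := hdiv _ (Ideal.Quotient.eq_zero_iff_mem.1 ha)
    rwa [prj_inc] at this
  have hker : LinearMap.ker (Psi hmN d hf0 hdiv hX) =
      Submodule.span ℂ {((⟨f₀, hf⟩, 0) : homogeneousSubmodule (Fin (m + 1)) ℂ d ×
      ({i : Fin (N + 1) // m < (i : ℕ)} → homogeneousSubmodule (Fin (m + 1)) ℂ 1))} := by
    apply le_antisymm
    · rintro ⟨⟨a, ha⟩, b⟩ hp
      rw [LinearMap.mem_ker] at hp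
      rw [Submodule.mem_span_singleton]
      have h1 := hzero a (by
        have := LinearMap.congr_fun hp ⟨_, hfI⟩
        rwa [Psi_apply, val_f hmN hf0] at this)
      have h2 : ∀ j, b j = 0 := by
        intro j
        have h3 := hzero (b j) (by
          have := LinearMap.congr_fun hp ⟨_, hX j.1 j.2⟩
          rwa [Psi_apply, val_X hmN hf0] at this)
        by_contra hne
        have hne' : (b j : MvPolynomial (Fin (m + 1)) ℂ) ≠ 0 := fun h => hne (Subtype.ext h)
        have h4 := totalDegree_le_of_dvd_of_isDomain h3 hne'
        have h5 : (b j : MvPolynomial (Fin (m + 1)) ℂ).IsHomogeneous 1 := (b j).2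
        rw [hf.totalDegree hf0, h5.totalDegree hne'] at h4
        omega
      obtain ⟨c, rfl⟩ := h1
      have hc : c.IsHomogeneous 0 := aux_div hf0 hf ha
      rw [← totalDegree_zero_iff_isHomogeneous, totalDegree_eq_zero_iff_eq_C] at hc
      refine ⟨coeff 0 c, Prod.ext (Subtype.ext ?_) (funext fun j => ?_)⟩
      · change coeff 0 c • f₀ = f₀ * c
        rw [smul_eq_C_mul, ← hc, mul_comm]
      · simp [h2 j]
    · rw [Submodule.span_singleton_le_iff_mem, LinearMap.mem_ker]
      apply ext_span hI
      rintro x hx (rfl | ⟨i, hi, rfl⟩)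
      · rw [Psi_apply, val_f hmN hf0]
        exact Ideal.Quotient.eq_zero_iff_mem.2 hfI
      · rw [Psi_apply, val_X hmN hf0 hdiv _ _ ⟨i, hi⟩]
        simp
  have := aux_fin m d
  have := aux_fin m 1
  have hrn := LinearMap.finrank_range_add_finrank_ker (Psi hmN d hf0 hdiv hX)
  rw [hrange, hker, finrank_span_singleton, Module.finrank_prod, Module.finrank_pi_fintype] at hrn
  · simp only [aux_finrank, Finset.sum_const, Finset.card_univ, smul_eq_mul] at hrn
    have hcard : Fintype.card {i : Fin (N + 1) // m < (i : ℕ)} = N - m := by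
      rw [Fintype.card_subtype]
      have := Fin.card_Ioi (⟨m, by omega⟩ : Fin (N + 1))
      have e : Finset.univ.filter (fun i : Fin (N + 1) => m < (i : ℕ)) =
        Finset.Ioi (⟨m, by omega⟩ : Fin (N + 1)) := by
        ext i
        simp [Fin.lt_def]
      rw [e, this]
      simp
    rw [hcard, Nat.choose_succ_self_right] at hrn
    have hpos : 0 < Nat.choose (m + d) m := Nat.choose_pos (by omega)
    omega
  · intro h
    exact hf0 (congrArg Subtype.val (congrArg Prod.fst h))
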